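/- Let 1 < p ≤ 2 and let q satisfy 1/p + 1/q = 1. Suppose f ∈ L^1(ℝ), a, b, C > 0, |f(x)| ≤ C e^{-a^p |x|^p / p} for all x ∈ ℝ, |f̂(ξ)| ≤ C e^{-b^q |ξ|^q / q} for all ξ ∈ ℝ, and a·b > |cos(pπ/2)|^{1/p}. Then f = 0 almost everywhere. -/

import Mathlib

open MeasureTheory

/-- The Fourier transform on `ℝ` with normalization
`f̂(ξ) = (2π)^(-1/2) ∫ f(x) e^(-i x ξ) dx`. -/
noncomputable def fourierTransform1d (f : ℝ → ℂ) (ξ : ℝ) : ℂ :=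
  ((Real.sqrt (2 * Real.pi))⁻¹ : ℝ) * ∫ x : ℝ, Complex.exp (-Complex.I * x * ξ) * f x

open Filter Asymptotics in
/-- A Phragmén–Lindelöf estimate in the sector `0 ≤ arg z ≤ θ₁` for an entire function of order
`p` which decays on the positive real axis. -/
lemma norm_le_of_decay_on_ray {F : ℂ → ℂ} (hF : Differentiable ℂ F) {p A B K θ₁ : ℝ}
    (hp : 0 < p) (hB : 0 ≤ B) (hθ : 0 < θ₁) (hpθ : p * θ₁ < Real.pi)
    (hgrow : ∀ z, ‖F z‖ ≤ K * Real.exp (B * ‖z‖ ^ p))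
    (hreal : ∀ x : ℝ, 0 < x → ‖F x‖ ≤ K * Real.exp (-A * x ^ p))
    {r θ : ℝ} (hr : 0 < r) (h0 : 0 ≤ θ) (h1 : θ ≤ θ₁) :
    ‖F (r * Complex.exp (θ * Complex.I))‖ ≤ K * Real.exp
      ((B * Real.sin (p * θ) - A * Real.sin (p * (θ₁ - θ))) / Real.sin (p * θ₁) * r ^ p) := by
  have hs : 0 < Real.sin (p * θ₁) := Real.sin_pos_of_pos_of_lt_pi (by positivity) hpθ
  set β : ℝ := (A * Real.cos (p * θ₁) + B) / Real.sin (p * θ₁) with hβ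
  set G : ℂ → ℂ := fun ζ ↦ F (Complex.exp ζ) *
    Complex.exp ((A + β * Complex.I) * Complex.exp (p * ζ)) with hG
  have hGd : Differentiable ℂ G := by
    refine (hF.comp Complex.differentiable_exp).mul ?_
    fun_prop
  have hexp : ∀ ζ : ℂ, ‖Complex.exp ((A + β * Complex.I) * Complex.exp (p * ζ))‖ =
      Real.exp (Real.exp (p * ζ.re) *
        (A * Real.cos (p * ζ.im) - β * Real.sin (p * ζ.im))) := by
    intro ζ
    rw [Complex.norm_exp]
    congr 1
    simp [Complex.exp_re, Complex.exp_im]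
    ring
  have hnorm : ∀ ζ : ℂ, ‖Complex.exp ζ‖ ^ p = Real.exp (p * ζ.re) := by
    intro ζ
    rw [Complex.norm_exp, ← Real.exp_mul, mul_comm]
  have hF0 : ∀ ζ : ℂ, ‖F (Complex.exp ζ)‖ ≤ K * Real.exp (B * Real.exp (p * ζ.re)) := by
    intro ζ
    rw [← hnorm]
    exact hgrow _
  have hK : 0 ≤ K := by
    have := (norm_nonneg _).trans (hgrow 0)
    exact nonneg_of_mul_nonneg_left this (Real.exp_pos _)
  have key : ∀ ζ : ℂ, 0 ≤ ζ.im → ζ.im ≤ θ₁ → ‖G ζ‖ ≤ K := by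
    intro ζ hζ0 hζ1
    refine PhragmenLindelof.horizontal_strip (a := 0) (b := θ₁) hGd.diffContOnCl
      ⟨p, ?_, B + (|A| + |β|), ?_⟩ ?_ ?_ hζ0 hζ1
    · rw [sub_zero, lt_div_iff₀ hθ]
      exact hpθ
    · refine IsBigO.of_bound K (Eventually.of_forall fun z ↦ ?_)
      rw [hG, norm_mul, hexp, Real.norm_of_nonneg (Real.exp_pos _).le]
      have hx : Real.exp (p * z.re) ≤ Real.exp (p * |z.re|) := by
        gcongr
        exact le_abs_self _
      have h3 : A * Real.cos (p * z.im) - β * Real.sin (p * z.im) ≤ |A| + |β| := by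
        have e1 : |A * Real.cos (p * z.im)| ≤ |A| := by
          rw [abs_mul]
          exact mul_le_of_le_one_right (abs_nonneg _) (Real.abs_cos_le_one _)
        have e2 : |β * Real.sin (p * z.im)| ≤ |β| := by
          rw [abs_mul]
          exact mul_le_of_le_one_right (abs_nonneg _) (Real.abs_sin_le_one _)
        linarith [le_abs_self (A * Real.cos (p * z.im)), neg_abs_le (β * Real.sin (p * z.im))]
      calc _ ≤ K * Real.exp (B * Real.exp (p * z.re)) * Real.exp (Real.exp (p * z.re) *
            (|A| + |β|)) := by
            gcongr
            exact hF0 z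
        _ = K * Real.exp ((B + (|A| + |β|)) * Real.exp (p * z.re)) := by
            rw [mul_assoc, ← Real.exp_add]
            ring_nf
        _ ≤ _ := by gcongr
    · intro z hz
      rw [hG, norm_mul, hexp, hz]
      have hz' : Complex.exp z = ((Real.exp z.re : ℝ) : ℂ) := by
        rw [Complex.ofReal_exp]
        congr 1
        apply Complex.ext <;> simp [hz]
      have := hreal (Real.exp z.re) (Real.exp_pos _)
      rw [← Real.exp_mul, mul_comm z.re] at this
      rw [hz']
      calc _ ≤ K * Real.exp (-A * Real.exp (p * z.re)) * Real.exp (Real.exp (p * z.re) *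
            (A * Real.cos (p * 0) - β * Real.sin (p * 0))) := by gcongr
        _ = K := by
            rw [mul_assoc, ← Real.exp_add]
            ring_nf
            simp
    · intro z hz
      rw [hG, norm_mul, hexp, hz]
      have hval : A * Real.cos (p * θ₁) - β * Real.sin (p * θ₁) = -B := by
        rw [hβ]
        field_simp
        ring
      rw [hval]
      calc _ ≤ K * Real.exp (B * Real.exp (p * z.re)) * Real.exp (Real.exp (p * z.re) * -B) := by
            gcongr
            exact hF0 z
        _ = K := by
            rw [mul_assoc, ← Real.exp_add]
            ring_nf
            simp
  have h := key (Real.log r + θ * Complex.I) (by simpa using h0) (by simpa using h1)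
  have hre : Complex.exp (Real.log r + θ * Complex.I) = r * Complex.exp (θ * Complex.I) := by
    rw [Complex.exp_add, ← Complex.ofReal_exp, Real.exp_log hr]
  have hrp : Real.exp (p * Real.log r) = r ^ p := by
    rw [Real.rpow_def_of_pos hr, mul_comm]
  rw [hG, norm_mul, hexp, hre] at h
  simp only [Complex.add_re, Complex.ofReal_re, Complex.mul_re, Complex.I_re, mul_zero,
    Complex.ofReal_im, Complex.I_im, mul_one, sub_self, add_zero, Complex.add_im,
    Complex.mul_im, zero_add, hrp] at h
  rw [← le_div_iff₀ (Real.exp_pos _), div_eq_mul_inv, ← Real.exp_neg] at h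
  refine h.trans_eq ?_
  congr 2
  rw [hβ, mul_sub p, Real.sin_sub]
  field_simp
  ring

open Filter Asymptotics Topology in
/-- An entire function of order `p` decaying like `exp (-κ r ^ p)` on the two boundary rays of
the sector `|arg z| ≤ π / (2 p)` vanishes identically. -/
lemma eq_zero_of_decay_on_critical_sector {F : ℂ → ℂ} (hF : Differentiable ℂ F)
    {p κ B K : ℝ} (hp : 0 < p) (hκ : 0 < κ) (hB : 0 ≤ B)
    (hgrow : ∀ z, ‖F z‖ ≤ K * Real.exp (B * ‖z‖ ^ p))
    (hray : ∀ r : ℝ, 0 < r →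
      ‖F (r * Complex.exp ((Real.pi / (2 * p) : ℝ) * Complex.I))‖ ≤ K * Real.exp (-κ * r ^ p))
    (hray' : ∀ r : ℝ, 0 < r →
      ‖F (r * Complex.exp ((-(Real.pi / (2 * p)) : ℝ) * Complex.I))‖ ≤ K * Real.exp (-κ * r ^ p)) :
    F = 0 := by
  have hK : 0 ≤ K := by
    have := (norm_nonneg _).trans (hgrow 0)
    exact nonneg_of_mul_nonneg_left this (Real.exp_pos _)
  set ε : ℝ := κ / 2 with hε
  have hε0 : 0 < ε := by positivity
  have hπ := Real.pi_pos
  set g : ℂ → ℂ := fun w ↦ F (w ^ ((p⁻¹ : ℝ) : ℂ)) *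
    Complex.exp (-ε * (w * Complex.log (1 + w))) with hg
  have hgrow' : ∀ w : ℂ, ‖F (w ^ ((p⁻¹ : ℝ) : ℂ))‖ ≤ K * Real.exp (B * ‖w‖) := by
    intro w
    refine (hgrow _).trans_eq ?_
    rw [Complex.norm_cpow_real, ← Real.rpow_mul (norm_nonneg _), inv_mul_cancel₀ hp.ne',
      Real.rpow_one]
  have hslit : ∀ w : ℂ, 0 ≤ w.re → 1 + w ∈ Complex.slitPlane := by
    intro w hw
    left
    simp
    linarith
  have hzero : Set.EqOn g 0 {z : ℂ | 0 ≤ z.re} := by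
    apply PhragmenLindelof.eq_zero_on_right_half_plane_of_superexponential_decay
    · constructor
      · intro w hw
        apply DifferentiableAt.differentiableWithinAt
        have hw' : w ∈ Complex.slitPlane := Or.inl hw
        have h1 := hslit w (le_of_lt hw)
        refine DifferentiableAt.mul ?_ ?_
        · exact hF.differentiableAt.comp w
            (differentiableAt_id.cpow (differentiableAt_const _) hw')
        · exact (((differentiableAt_id.mul
            ((differentiableAt_id.const_add 1).clog h1)).const_mul (-(ε : ℂ)))).cexp
      · rw [Complex.closure_setOfPred_lt_re]
        intro w hw
        apply ContinuousAt.continuousWithinAt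
        have h1 := hslit w hw
        refine ContinuousAt.mul ?_ ?_
        · refine hF.continuous.continuousAt.comp ?_
          exact Complex.continuousAt_cpow_const_of_re_pos (Or.inl hw) (by simpa using hp)
        · refine Complex.continuous_exp.continuousAt.comp ?_
          exact continuousAt_const.mul (continuousAt_id.mul
            ((continuousAt_const.add continuousAt_id).clog h1))
    · refine ⟨3 / 2, by norm_num, B + ε * (2 * (2 : ℝ) ^ (1 / 2 : ℝ) + Real.pi), ?_⟩
      refine IsBigO.of_bound K ?_
      have hev : ∀ᶠ w : ℂ in Bornology.cobounded ℂ, 1 ≤ ‖w‖ :=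
        tendsto_norm_cobounded_atTop.eventually_ge_atTop 1
      filter_upwards [hev.filter_mono inf_le_left, mem_inf_of_right (mem_principal_self _)]
        with w hw1 hw
      rw [hg, norm_mul, Real.norm_of_nonneg (Real.exp_pos _).le, Complex.norm_exp]
      have hlog : ‖Complex.log (1 + w)‖ ≤
          (2 * (2 : ℝ) ^ (1 / 2 : ℝ) + Real.pi) * ‖w‖ ^ (1 / 2 : ℝ) := by
        have hone : 1 ≤ ‖w‖ ^ (1 / 2 : ℝ) := Real.one_le_rpow hw1 (by norm_num)
        have hre : 1 ≤ ‖1 + w‖ := by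
          refine le_trans ?_ (Complex.re_le_norm _)
          simp
          exact le_of_lt hw
        have e1 : |Real.log ‖1 + w‖| ≤ 2 * ((2 : ℝ) ^ (1 / 2 : ℝ) * ‖w‖ ^ (1 / 2 : ℝ)) := by
          rw [abs_of_nonneg (Real.log_nonneg hre), ← Real.mul_rpow (by norm_num) (norm_nonneg _)]
          have := Real.log_le_rpow_div (norm_nonneg (1 + w)) (ε := 1 / 2) (by norm_num)
          refine this.trans ?_
          rw [div_eq_mul_inv, mul_comm]
          norm_num
          gcongr
          refine (norm_add_le _ _).trans ?_
          simp
          linarith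
        have e2 : |(1 + w).arg| ≤ Real.pi := Complex.abs_arg_le_pi _
        refine (Complex.norm_le_abs_re_add_abs_im _).trans ?_
        rw [Complex.log_re, Complex.log_im]
        nlinarith
      have hre : (-(ε : ℂ) * (w * Complex.log (1 + w))).re ≤ ε * (‖w‖ * ‖Complex.log (1 + w)‖) := by
        refine (Complex.re_le_norm _).trans_eq ?_
        simp [abs_of_pos hε0]
      have h32 : ‖w‖ ^ (3 / 2 : ℝ) = ‖w‖ * ‖w‖ ^ (1 / 2 : ℝ) := by
        rw [← Real.rpow_one_add' (norm_nonneg _) (by norm_num)]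
        norm_num
      have hone : 1 ≤ ‖w‖ ^ (1 / 2 : ℝ) := Real.one_le_rpow hw1 (by norm_num)
      calc _ ≤ K * Real.exp (B * ‖w‖) * Real.exp (ε * (‖w‖ * ‖Complex.log (1 + w)‖)) := by
            gcongr
            exact hgrow' w
        _ = K * Real.exp (B * ‖w‖ + ε * (‖w‖ * ‖Complex.log (1 + w)‖)) := by
            rw [mul_assoc, ← Real.exp_add]
        _ ≤ _ := by
            gcongr
            rw [h32, add_mul]
            refine add_le_add ?_ ?_
            · exact mul_le_mul_of_nonneg_left (le_mul_of_one_le_right (norm_nonneg _) hone) hB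
            · calc _ ≤ ε * (‖w‖ * ((2 * (2 : ℝ) ^ (1 / 2 : ℝ) + Real.pi) * ‖w‖ ^ (1 / 2 : ℝ))) := by
                    gcongr
                _ = _ := by ring
    · intro n
      have hmain : ∀ᶠ x : ℝ in atTop, ‖g x‖ ≤ K * Real.exp (-((n : ℝ) + 1) * x) := by
        have hlog : ∀ᶠ x : ℝ in atTop, (B + n + 1) / ε ≤ Real.log (1 + x) :=
          (Real.tendsto_log_atTop.comp
            (tendsto_atTop_add_const_left _ 1 tendsto_id)).eventually_ge_atTop _
        filter_upwards [hlog, eventually_ge_atTop 0] with x hx hx0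
        rw [hg, norm_mul, Complex.norm_exp]
        have hre : (-(ε : ℂ) * ((x : ℂ) * Complex.log (1 + x))).re = -ε * (x * Real.log (1 + x)) := by
          have : (1 + (x : ℂ)) = ((1 + x : ℝ) : ℂ) := by push_cast; rfl
          rw [this, ← Complex.ofReal_log (by linarith)]
          norm_cast
        rw [hre]
        have h1 := hgrow' x
        rw [Complex.norm_real, Real.norm_of_nonneg hx0] at h1
        rw [div_le_iff₀ hε0] at hx
        calc _ ≤ K * Real.exp (B * x) * Real.exp (-ε * (x * Real.log (1 + x))) := by gcongr
          _ = K * Real.exp (B * x + -ε * (x * Real.log (1 + x))) := by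
            rw [mul_assoc, ← Real.exp_add]
          _ ≤ _ := by
            gcongr
            nlinarith
      refine squeeze_zero' (Eventually.of_forall fun x ↦ by positivity)
        (g := fun x ↦ K * Real.exp (-x)) ?_ ?_
      · filter_upwards [hmain] with x hx
        calc _ ≤ Real.exp x ^ n * (K * Real.exp (-((n : ℝ) + 1) * x)) := by gcongr
          _ = _ := by
            rw [← Real.exp_nat_mul, mul_left_comm, ← Real.exp_add]
            ring_nf
      · simpa using (Real.tendsto_exp_neg_atTop_nhds_zero).const_mul K
    · refine ⟨max K (‖g 0‖), fun y ↦ ?_⟩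
      rcases eq_or_ne y 0 with rfl | hy
      · simp
      refine le_max_of_le_left ?_
      have hfac : (-(ε : ℂ) * ((y * Complex.I) * Complex.log (1 + y * Complex.I))).re
          ≤ κ * |y| := by
        have : (-(ε : ℂ) * ((y * Complex.I) * Complex.log (1 + y * Complex.I))).re =
            ε * (y * (1 + y * Complex.I).arg) := by
          simp [Complex.log_im]
        rw [this]
        have h2 : y * (1 + y * Complex.I).arg ≤ |y| * 2 := by
          refine (le_abs_self _).trans ?_
          rw [abs_mul]
          gcongr
          refine (Complex.abs_arg_le_pi_div_two_iff.2 (by simp)).trans ?_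
          linarith [Real.pi_le_four]
        calc _ ≤ ε * (|y| * 2) := by gcongr
          _ = _ := by rw [hε]; ring
      have hFy : ‖F ((y * Complex.I : ℂ) ^ ((p⁻¹ : ℝ) : ℂ))‖ ≤ K * Real.exp (-κ * |y|) := by
        have hyp : 0 < |y| := abs_pos.2 hy
        have hr : 0 < |y| ^ (p⁻¹ : ℝ) := by positivity
        have hrp : (|y| ^ (p⁻¹ : ℝ)) ^ p = |y| := by
          rw [← Real.rpow_mul hyp.le, inv_mul_cancel₀ hp.ne', Real.rpow_one]
        have hyI : (y * Complex.I : ℂ) ≠ 0 := by simp [hy]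
        have hpow : ∀ s : ℝ, (y * Complex.I : ℂ).arg = s → (y * Complex.I : ℂ) ^ ((p⁻¹ : ℝ) : ℂ) =
            ((|y| ^ (p⁻¹ : ℝ) : ℝ) : ℂ) * Complex.exp ((s / p : ℝ) * Complex.I) := by
          intro s hs
          rw [Complex.cpow_def_of_ne_zero hyI, Complex.log, hs, Real.rpow_def_of_pos hyp,
            Complex.ofReal_exp, ← Complex.exp_add]
          congr 1
          simp
          ring
        rcases lt_or_gt_of_ne hy with hneg | hpos
        · rw [hpow (-(Real.pi / 2))]
          · have := hray' _ hr
            rw [hrp] at this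
            rwa [show -(Real.pi / 2) / p = -(Real.pi / (2 * p)) by field_simp]
          · rw [Complex.arg_eq_neg_pi_div_two_iff]
            simpa using hneg
        · rw [hpow (Real.pi / 2)]
          · have := hray _ hr
            rw [hrp] at this
            rwa [show (Real.pi / 2) / p = (Real.pi / (2 * p)) by field_simp]
          · rw [Complex.arg_eq_pi_div_two_iff]
            simpa using hpos
      rw [hg, norm_mul, Complex.norm_exp]
      calc _ ≤ K * Real.exp (-κ * |y|) * Real.exp (κ * |y|) := by gcongr
        _ = K := by
          rw [mul_assoc, ← Real.exp_add]
          simp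
  have hpos : ∀ x : ℝ, 0 < x → F x = 0 := by
    intro x hx
    have h := hzero (x := ((x ^ p : ℝ) : ℂ)) (by simp; positivity)
    simp only [hg, Pi.zero_apply, mul_eq_zero, Complex.exp_ne_zero, or_false] at h
    rwa [← Complex.ofReal_cpow (by positivity), ← Real.rpow_mul hx.le, mul_inv_cancel₀ hp.ne',
      Real.rpow_one] at h
  have han : AnalyticOnNhd ℂ F Set.univ := fun z _ ↦ hF.analyticAt z
  refine han.eq_of_frequently_eq (z₀ := 0) (fun z _ ↦ analyticAt_const) ?_
  have hlim : Tendsto (fun x : ℝ ↦ (x : ℂ)) (𝓝[>] 0) (𝓝[≠] 0) := by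
    refine tendsto_nhdsWithin_iff.2 ⟨?_, ?_⟩
    · exact (Complex.continuous_ofReal.tendsto' 0 0 (by simp)).mono_left nhdsWithin_le_nhds
    · filter_upwards [self_mem_nhdsWithin] with x hx
      simpa using (ne_of_gt hx)
  refine hlim.frequently (Eventually.frequently ?_)
  filter_upwards [self_mem_nhdsWithin] with x hx
  exact hpos x hx

open FourierTransform in
/-- Fourier inversion almost everywhere for integrable functions with integrable transform. -/
lemma fourierInv_fourier_ae_eq {f : ℝ → ℂ} (hf : Integrable f) (hf' : Integrable (𝓕 f)) :
    f =ᵐ[volume] 𝓕⁻ (𝓕 f) := by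
  have hcont : Continuous (𝓕⁻ (𝓕 f)) :=
    VectorFourier.fourierIntegral_continuous Real.continuous_fourierChar
      (by exact continuous_inner.neg) hf'
  refine ae_eq_of_integral_contDiff_smul_eq hf.locallyIntegrable hcont.locallyIntegrable ?_
  intro φ hφ hφc
  have hc : HasCompactSupport fun x ↦ (φ x : ℂ) := hφc.comp_left (g := Complex.ofReal) rfl
  set ψ : SchwartzMap ℝ ℂ := hc.toSchwartzMap (Complex.ofRealCLM.contDiff.comp hφ) with hψ
  have hψφ : ∀ x, ψ x = φ x := fun x ↦ rfl
  obtain ⟨χ, hχ⟩ : ∃ χ : SchwartzMap ℝ ℂ, χ = 𝓕⁻ ψ := ⟨_, rfl⟩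
  have h1 : ∫ x, 𝓕 (χ : ℝ → ℂ) x • f x = ∫ x, χ x • 𝓕 f x := by
    have h := VectorFourier.integral_fourierIntegral_smul_eq_flip (L := innerₗ ℝ)
      (μ := volume) (ν := volume) Real.continuous_fourierChar continuous_inner
      (f := χ) (g := f) χ.integrable hf
    rw [flip_innerₗ] at h
    exact h
  have h2 : ∫ x, 𝓕⁻ (ψ : ℝ → ℂ) x • 𝓕 f x = ∫ x, ψ x • 𝓕⁻ (𝓕 f) x := by
    have h := VectorFourier.integral_fourierIntegral_smul_eq_flip (L := -innerₗ ℝ)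
      (μ := volume) (ν := volume) Real.continuous_fourierChar (by exact continuous_inner.neg)
      (f := ψ) (g := 𝓕 f) ψ.integrable hf'
    have hfl : (-innerₗ ℝ).flip = (-innerₗ ℝ : ℝ →ₗ[ℝ] ℝ →ₗ[ℝ] ℝ) := by
      ext
      simp
    rw [hfl] at h
    exact h
  have h3 : 𝓕 (χ : ℝ → ℂ) = ψ := by
    rw [← SchwartzMap.fourier_coe, hχ, fourier_fourierInv_eq]
  rw [h3, hχ, SchwartzMap.fourierInv_coe, h2] at h1
  simpa [hψφ, Complex.real_smul] using h1

lemma integrable_exp_mul_abs_sub_rpow (R : ℝ) {s q : ℝ} (hs : 0 < s) (hq : 2 ≤ q) :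
    Integrable fun ξ : ℝ ↦ Real.exp (R * |ξ| - s * |ξ| ^ q) := by
  have hg := (integrable_exp_neg_mul_sq (b := s / 2) (by positivity)).const_mul
    (Real.exp (s + R ^ 2 / (2 * s)))
  refine hg.mono' ?_ (Filter.Eventually.of_forall fun ξ ↦ ?_)
  · have : Continuous fun ξ : ℝ ↦ Real.exp (R * |ξ| - s * |ξ| ^ q) := by
      have : Continuous fun ξ : ℝ ↦ |ξ| ^ q :=
        continuous_abs.rpow_const fun _ ↦ Or.inr (by linarith)
      fun_prop
    exact this.aestronglyMeasurable
  · rw [Real.norm_of_nonneg (Real.exp_pos _).le, ← Real.exp_add]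
    gcongr
    have h1 : |ξ| ^ 2 - 1 ≤ |ξ| ^ q := by
      rcases le_total |ξ| 1 with h | h
      · have : |ξ| ^ 2 ≤ 1 := pow_le_one₀ (abs_nonneg _) h
        linarith [Real.rpow_nonneg (abs_nonneg ξ) q]
      · have := Real.rpow_le_rpow_of_exponent_le h hq
        rw [Real.rpow_two] at this
        linarith
    have h2 : R * |ξ| ≤ s / 2 * |ξ| ^ 2 + R ^ 2 / (2 * s) := by
      have : s / 2 * |ξ| ^ 2 + R ^ 2 / (2 * s) - R * |ξ| = (s * |ξ| - R) ^ 2 / (2 * s) := by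
        field_simp
        ring
      have h3 : 0 ≤ (s * |ξ| - R) ^ 2 / (2 * s) := by positivity
      linarith
    rw [← sq_abs ξ]
    nlinarith

lemma norm_cexp_mul_le {g : ℝ → ℂ} {s q C : ℝ}
    (hgC : ∀ ξ, ‖g ξ‖ ≤ C * Real.exp (-(s * |ξ| ^ q))) (z : ℂ) (ξ : ℝ) :
    ‖Complex.exp (Complex.I * z * ξ) * g ξ‖ ≤ C * Real.exp (|z.im| * |ξ| - s * |ξ| ^ q) := by
  rw [norm_mul, Complex.norm_exp, sub_eq_add_neg, Real.exp_add, mul_left_comm]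
  gcongr
  · simp
    rw [← abs_mul]
    exact neg_le_abs _
  · exact hgC ξ

/-- The Fourier–Laplace transform of a function with super-Gaussian decay is entire. -/
lemma differentiable_integral_cexp_mul {g : ℝ → ℂ} (hg : Continuous g) {s q C : ℝ}
    (hs : 0 < s) (hq : 2 ≤ q) (hgC : ∀ ξ, ‖g ξ‖ ≤ C * Real.exp (-(s * |ξ| ^ q))) :
    Differentiable ℂ fun z : ℂ ↦ ∫ ξ : ℝ, Complex.exp (Complex.I * z * ξ) * g ξ := by
  intro z₀
  have hC : 0 ≤ C := nonneg_of_mul_nonneg_left ((norm_nonneg _).trans (hgC 0)) (Real.exp_pos _)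
  refine (hasDerivAt_integral_of_dominated_loc_of_deriv_le (𝕜 := ℂ) (μ := volume)
    (F := fun (z : ℂ) (ξ : ℝ) ↦ Complex.exp (Complex.I * z * ξ) * g ξ)
    (F' := fun (z : ℂ) (ξ : ℝ) ↦ Complex.exp (Complex.I * z * ξ) * (Complex.I * ξ) * g ξ)
    (bound := fun ξ ↦ C * Real.exp ((‖z₀‖ + 2) * |ξ| - s * |ξ| ^ q))
    (Metric.ball_mem_nhds z₀ one_pos) ?_ ?_ ?_ ?_ ?_ ?_).2.differentiableAt
  · refine Filter.Eventually.of_forall fun z ↦ Continuous.aestronglyMeasurable ?_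
    fun_prop
  · refine ((integrable_exp_mul_abs_sub_rpow |z₀.im| hs hq).const_mul C).mono' ?_
      (Filter.Eventually.of_forall fun ξ ↦ norm_cexp_mul_le hgC z₀ ξ)
    exact Continuous.aestronglyMeasurable (by fun_prop)
  · exact Continuous.aestronglyMeasurable (by fun_prop)
  · refine Filter.Eventually.of_forall fun ξ z hz ↦ ?_
    have h1 := norm_cexp_mul_le hgC z ξ
    have hz' : |z.im| ≤ ‖z₀‖ + 1 := by
      refine (Complex.abs_im_le_norm z).trans ?_
      rw [mem_ball_iff_norm] at hz
      have := norm_add_le (z - z₀) z₀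
      rw [sub_add_cancel] at this
      linarith
    have h2 : |ξ| ≤ Real.exp |ξ| := by linarith [Real.add_one_le_exp |ξ|]
    calc _ = |ξ| * ‖Complex.exp (Complex.I * z * ξ) * g ξ‖ := by
          simp only [norm_mul, Complex.norm_I, Complex.norm_real, Real.norm_eq_abs]
          ring
      _ ≤ Real.exp |ξ| * (C * Real.exp (|z.im| * |ξ| - s * |ξ| ^ q)) := by gcongr
      _ = C * Real.exp ((|z.im| + 1) * |ξ| - s * |ξ| ^ q) := by
          rw [mul_left_comm, ← Real.exp_add]
          ring_nf
      _ ≤ _ := by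
          have h3 : |z.im| + 1 ≤ ‖z₀‖ + 2 := by linarith
          gcongr
  · exact (integrable_exp_mul_abs_sub_rpow _ hs hq).const_mul C
  · refine Filter.Eventually.of_forall fun ξ z _ ↦ ?_
    have h : HasDerivAt (fun z : ℂ ↦ Complex.I * z * ξ) (Complex.I * ξ) z := by
      simpa using ((hasDerivAt_id z).const_mul Complex.I).mul_const (ξ : ℂ)
    exact h.cexp.mul_const _

/-- Growth of the Fourier–Laplace transform, by Young's inequality. -/
lemma norm_integral_cexp_mul_le {g : ℝ → ℂ} {p q b b' C : ℝ} (hpq : p.HolderConjugate q)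
    (hq : 2 ≤ q) (hb' : 0 < b') (hbb' : b' < b)
    (hgC : ∀ ξ, ‖g ξ‖ ≤ C * Real.exp (-(b ^ q / q * |ξ| ^ q))) :
    ∃ K, ∀ z : ℂ, ‖∫ ξ : ℝ, Complex.exp (Complex.I * z * ξ) * g ξ‖ ≤
      K * Real.exp (1 / (p * b' ^ p) * ‖z‖ ^ p) := by
  have hC : 0 ≤ C := nonneg_of_mul_nonneg_left ((norm_nonneg _).trans (hgC 0)) (Real.exp_pos _)
  have hp : 0 < p := hpq.pos
  have hs : 0 < b ^ q / q - b' ^ q / q := by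
    have : b' ^ q < b ^ q := Real.rpow_lt_rpow hb'.le hbb' (by linarith)
    rw [← sub_div]
    exact div_pos (by linarith) (by linarith)
  refine ⟨∫ ξ : ℝ, C * Real.exp (0 * |ξ| - (b ^ q / q - b' ^ q / q) * |ξ| ^ q), fun z ↦ ?_⟩
  rw [← integral_mul_const]
  refine norm_integral_le_of_norm_le
    (((integrable_exp_mul_abs_sub_rpow 0 hs hq).const_mul C).mul_const _)
    (Filter.Eventually.of_forall fun ξ ↦ ?_)
  refine (norm_cexp_mul_le hgC z ξ).trans ?_
  rw [mul_assoc, ← Real.exp_add]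
  gcongr
  have hY := Real.young_inequality_of_nonneg (a := |z.im| / b') (b := b' * |ξ|) (by positivity)
    (by positivity) hpq
  rw [Real.div_rpow (abs_nonneg _) hb'.le, Real.mul_rpow hb'.le (abs_nonneg _)] at hY
  have h1 : |z.im| / b' * (b' * |ξ|) = |z.im| * |ξ| := by field_simp
  have h2 : |z.im| ^ p / b' ^ p / p ≤ 1 / (p * b' ^ p) * ‖z‖ ^ p := by
    have : |z.im| ^ p ≤ ‖z‖ ^ p := by
      gcongr
      exact Complex.abs_im_le_norm z
    calc _ = 1 / (p * b' ^ p) * |z.im| ^ p := by field_simp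
      _ ≤ _ := by gcongr
  have h3 : b' ^ q * |ξ| ^ q / q = b' ^ q / q * |ξ| ^ q := by ring
  rw [h1, h3] at hY
  linarith

open FourierTransform in
lemma fourierTransform1d_eq (f : ℝ → ℂ) (ξ : ℝ) :
    fourierTransform1d f ξ = ((Real.sqrt (2 * Real.pi))⁻¹ : ℝ) * 𝓕 f ((2 * Real.pi)⁻¹ * ξ) := by
  rw [fourierTransform1d, Real.fourier_real_eq_integral_exp_smul]
  congr 2
  ext x
  rw [smul_eq_mul]
  congr 2
  have : (Real.pi : ℂ) ≠ 0 := by exact_mod_cast Real.pi_ne_zero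
  push_cast
  field_simp

open FourierTransform in
/-- Inversion formula for `fourierTransform1d`. -/
lemma ae_eq_integral_fourierTransform1d {f : ℝ → ℂ} (hf : Integrable f)
    (hf' : Integrable (fourierTransform1d f)) :
    ∀ᵐ x : ℝ, f x = ((Real.sqrt (2 * Real.pi))⁻¹ : ℝ) *
      ∫ ξ : ℝ, Complex.exp (Complex.I * x * ξ) * fourierTransform1d f ξ := by
  have hπ := Real.pi_pos
  have hsq : Real.sqrt (2 * Real.pi) ≠ 0 := by positivity
  have hF : ∀ v, 𝓕 f v =
      (Real.sqrt (2 * Real.pi) : ℝ) * fourierTransform1d f (2 * Real.pi * v) := by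
    intro v
    rw [fourierTransform1d_eq, ← mul_assoc, ← mul_assoc, inv_mul_cancel₀ (by positivity),
      one_mul, ← Complex.ofReal_mul, mul_inv_cancel₀ hsq]
    simp
  have hint : Integrable (𝓕 f) := by
    rw [funext hF]
    exact (hf'.comp_mul_left' (by positivity)).const_mul _
  filter_upwards [fourierInv_fourier_ae_eq hf hint] with x hx
  rw [hx, Real.fourierInv_eq']
  have : ∀ v : ℝ, Complex.exp ((2 * Real.pi * inner ℝ v x : ℝ) * Complex.I) • 𝓕 f v =
      (fun ξ : ℝ ↦ (Real.sqrt (2 * Real.pi) : ℝ) *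
        (Complex.exp (Complex.I * x * ξ) * fourierTransform1d f ξ)) (2 * Real.pi * v) := by
    intro v
    simp only [hF, smul_eq_mul]
    rw [mul_left_comm]
    congr 3
    simp
    ring
  simp_rw [this]
  rw [Measure.integral_comp_mul_left (fun ξ : ℝ ↦ (Real.sqrt (2 * Real.pi) : ℝ) *
        (Complex.exp (Complex.I * x * ξ) * fourierTransform1d f ξ)), integral_const_mul,
    Complex.real_smul, ← mul_assoc, ← Complex.ofReal_mul]
  congr 2
  rw [abs_of_pos (by positivity)]
  field_simp
  exact Real.sq_sqrt (by positivity)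

open FourierTransform in
lemma continuous_fourierTransform1d {f : ℝ → ℂ} (hf : Integrable f) :
    Continuous (fourierTransform1d f) := by
  have hcont : Continuous (𝓕 f) :=
    VectorFourier.fourierIntegral_continuous Real.continuous_fourierChar
      (by exact continuous_inner) hf
  rw [funext (fourierTransform1d_eq f)]
  fun_prop

open Filter Topology ComplexConjugate in
/-- An entire function of order `p ∈ (1, 2]` and type at most `B` which decays like
`exp (-A |x| ^ p)` on the real line vanishes identically once `B |cos (p π / 2)| < A`. -/
lemma eq_zero_of_growth_of_decay_on_real {F : ℂ → ℂ} (hF : Differentiable ℂ F) {p A B K : ℝ}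
    (hp1 : 1 < p) (hp2 : p ≤ 2) (hB : 0 ≤ B) (hAB : B * |Real.cos (p * Real.pi / 2)| < A)
    (hgrow : ∀ z, ‖F z‖ ≤ K * Real.exp (B * ‖z‖ ^ p))
    (hreal : ∀ x : ℝ, ‖F x‖ ≤ K * Real.exp (-A * |x| ^ p)) : F = 0 := by
  have hπ := Real.pi_pos
  have hp : 0 < p := by linarith
  obtain ⟨δ, hδ0, hδ1, hδA⟩ : ∃ δ : ℝ, 0 < δ ∧ δ < Real.pi / 2 ∧
      B * |Real.cos (p * Real.pi / 2)| < A * Real.cos δ := by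
    have hlim : Tendsto (fun δ : ℝ ↦ A * Real.cos δ) (𝓝[>] 0) (𝓝 A) := by
      have : Continuous fun δ : ℝ ↦ A * Real.cos δ := by fun_prop
      exact (this.tendsto' 0 A (by simp)).mono_left nhdsWithin_le_nhds
    have hsmall : ∀ᶠ δ : ℝ in 𝓝[>] 0, δ < Real.pi / 2 :=
      nhdsWithin_le_nhds (eventually_lt_nhds (by positivity))
    obtain ⟨δ, h1, h2, h3⟩ :=
      ((hlim.eventually_const_lt hAB).and (hsmall.and self_mem_nhdsWithin)).exists
    exact ⟨δ, h3, h2, h1⟩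
  set θ₁ : ℝ := (p * Real.pi / 2 - δ) / p with hθ₁
  set θ₀ : ℝ := Real.pi / 2 - Real.pi / (2 * p) with hθ₀
  have hpθ₁ : p * θ₁ = p * Real.pi / 2 - δ := by
    rw [hθ₁]
    field_simp
  have hpθ₀ : p * θ₀ = p * Real.pi / 2 - Real.pi / 2 := by
    rw [hθ₀]
    field_simp
  have hθ₁pos : 0 < p * θ₁ := by
    rw [hpθ₁]
    nlinarith
  have hθ₁lt : p * θ₁ < Real.pi := by
    rw [hpθ₁]
    nlinarith
  have hθ₀nonneg : 0 ≤ θ₀ := by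
    refine nonneg_of_mul_nonneg_right (a := p) ?_ hp
    rw [hpθ₀]
    nlinarith
  have hθ₀le : θ₀ ≤ θ₁ := by
    refine le_of_mul_le_mul_left (a := p) ?_ hp
    rw [hpθ₀, hpθ₁]
    linarith
  have hs : 0 < Real.sin (p * θ₁) := Real.sin_pos_of_pos_of_lt_pi hθ₁pos hθ₁lt
  have hcos : |Real.cos (p * Real.pi / 2)| = Real.sin (p * θ₀) := by
    rw [hpθ₀, Real.sin_sub_pi_div_two, abs_of_nonpos]
    exact Real.cos_nonpos_of_pi_div_two_le_of_le (by nlinarith) (by nlinarith)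
  have hcosδ : Real.sin (p * (θ₁ - θ₀)) = Real.cos δ := by
    rw [mul_sub, hpθ₁, hpθ₀, ← Real.sin_pi_div_two_sub]
    ring_nf
  set κ : ℝ := (A * Real.cos δ - B * |Real.cos (p * Real.pi / 2)|) / Real.sin (p * θ₁) with hκ
  have hκ0 : 0 < κ := div_pos (by linarith) hs
  have hray : ∀ G : ℂ → ℂ, Differentiable ℂ G →
      (∀ z, ‖G z‖ ≤ K * Real.exp (B * ‖z‖ ^ p)) →
      (∀ x : ℝ, ‖G x‖ ≤ K * Real.exp (-A * |x| ^ p)) → ∀ r : ℝ, 0 < r →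
      ‖G (r * Complex.exp (θ₀ * Complex.I))‖ ≤ K * Real.exp (-κ * r ^ p) := by
    intro G hG hGg hGr r hr
    refine (norm_le_of_decay_on_ray hG hp hB (pos_of_mul_pos_right hθ₁pos hp.le) hθ₁lt hGg
      (A := A) (fun x hx ↦ ?_) hr hθ₀nonneg hθ₀le).trans_eq ?_
    · simpa [abs_of_pos hx] using hGr x
    · rw [hcosδ, ← hcos, hκ]
      ring_nf
  have hI : Complex.exp ((Real.pi / 2 : ℝ) * Complex.I) = Complex.I := by
    push_cast
    exact Complex.exp_pi_div_two_mul_I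
  have hrot : ∀ r s : ℝ, Complex.I * (r * Complex.exp (s * Complex.I)) =
      r * Complex.exp ((Real.pi / 2 + s : ℝ) * Complex.I) := by
    intro r s
    rw [Complex.ofReal_add, add_mul, Complex.exp_add, hI]
    ring
  set F₁ : ℂ → ℂ := fun z ↦ conj (F (-conj z)) with hF₁
  have hF₁d : Differentiable ℂ F₁ := by
    intro z
    have h : DifferentiableAt ℂ (fun z ↦ F (-z)) (conj z) :=
      (hF.comp differentiable_neg).differentiableAt
    simpa [Function.comp_def] using h.conj_conj
  have hzero : (fun z ↦ F (Complex.I * z)) = 0 := by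
    refine eq_zero_of_decay_on_critical_sector (p := p) (κ := κ) (B := B) (K := K) ?_ hp hκ0 hB
      (fun z ↦ by simpa using hgrow (Complex.I * z)) (fun r hr ↦ ?_) fun r hr ↦ ?_
    · exact hF.comp (differentiable_id.const_mul Complex.I)
    · have h := hray F₁ hF₁d (fun z ↦ by simpa [hF₁] using hgrow (-conj z))
        (fun x ↦ by simpa [hF₁] using hreal (-x)) r hr
      rw [hrot]
      simp only [hF₁, Complex.norm_conj] at h
      convert h using 3
      rw [map_mul, ← Complex.exp_conj, map_mul, Complex.conj_ofReal, Complex.conj_ofReal,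
        Complex.conj_I, ← mul_neg, show Real.pi / 2 + Real.pi / (2 * p) = Real.pi - θ₀ by
          rw [hθ₀]; ring, Complex.ofReal_sub, sub_mul, sub_eq_add_neg, Complex.exp_add,
        Complex.exp_pi_mul_I, mul_neg]
      simp
    · rw [hrot, ← sub_eq_add_neg, ← hθ₀]
      exact hray F hF hgrow hreal r hr
  ext z
  have := congrFun hzero (-Complex.I * z)
  simpa [← mul_assoc] using this

/-- **Morgan's generalization of Hardy's uncertainty principle.** -/
theorem morgan_uncertainty (p q : ℝ) (hp1 : 1 < p) (hp2 : p ≤ 2)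
    (hpq : 1 / p + 1 / q = 1)
    (f : ℝ → ℂ) (hf : Integrable f volume)
    (a b C : ℝ) (ha : 0 < a) (hb : 0 < b) (hC : 0 < C)
    (hfd : ∀ x : ℝ, ‖f x‖ ≤ C * Real.exp (-(a ^ p * |x| ^ p / p)))
    (hFd : ∀ ξ : ℝ, ‖fourierTransform1d f ξ‖ ≤ C * Real.exp (-(b ^ q * |ξ| ^ q / q)))
    (hab : a * b > |Real.cos (p * Real.pi / 2)| ^ (1 / p)) :
    ∀ᵐ x : ℝ ∂volume, f x = 0 := by
  have hp : 0 < p := by linarith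
  have hconj : p.HolderConjugate q :=
    Real.holderConjugate_iff.2 ⟨hp1, by simpa only [one_div] using hpq⟩
  have hq0 : 0 < q := hconj.symm.pos
  have hq : 2 ≤ q := by
    have h1 : 1 / 2 ≤ 1 / p := one_div_le_one_div_of_le hp hp2
    have h2 : 1 / q ≤ 1 / 2 := by linarith
    exact (one_div_le_one_div hq0 two_pos).1 h2
  obtain ⟨b', hb'1, hbb'⟩ : ∃ b', |Real.cos (p * Real.pi / 2)| ^ (1 / p) / a < b' ∧ b' < b :=
    exists_between ((div_lt_iff₀' ha).2 hab)
  have hb' : 0 < b' := lt_of_le_of_lt (by positivity) hb'1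
  have hAB : 1 / (p * b' ^ p) * |Real.cos (p * Real.pi / 2)| < a ^ p / p := by
    have h1 : |Real.cos (p * Real.pi / 2)| < a ^ p * b' ^ p := by
      rw [div_lt_iff₀' ha] at hb'1
      have := Real.rpow_lt_rpow (by positivity) hb'1 hp
      rwa [← Real.rpow_mul (abs_nonneg _), one_div_mul_cancel hp.ne', Real.rpow_one,
        Real.mul_rpow ha.le hb'.le] at this
    have h2 : 0 < b' ^ p := by positivity
    rw [one_div_mul_eq_div, div_lt_div_iff₀ (by positivity) hp]
    nlinarith
  have hgC : ∀ ξ, ‖fourierTransform1d f ξ‖ ≤ C * Real.exp (-(b ^ q / q * |ξ| ^ q)) := by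
    intro ξ
    refine (hFd ξ).trans_eq ?_
    ring_nf
  have hs : 0 < b ^ q / q := by positivity
  have hcont := continuous_fourierTransform1d hf
  have hint : Integrable (fourierTransform1d f) := by
    refine ((integrable_exp_mul_abs_sub_rpow 0 hs hq).const_mul C).mono'
      hcont.aestronglyMeasurable (Filter.Eventually.of_forall fun ξ ↦ ?_)
    simpa using hgC ξ
  set F : ℂ → ℂ := fun z ↦ ((Real.sqrt (2 * Real.pi))⁻¹ : ℝ) *
    ∫ ξ : ℝ, Complex.exp (Complex.I * z * ξ) * fourierTransform1d f ξ with hFdef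
  have hFdiff : Differentiable ℂ F :=
    (differentiable_integral_cexp_mul hcont hs hq hgC).const_mul _
  have hfF : ∀ᵐ x : ℝ, f x = F x := ae_eq_integral_fourierTransform1d hf hint
  obtain ⟨K, hK⟩ := norm_integral_cexp_mul_le hconj hq hb' hbb' hgC
  have hreal : ∀ x : ℝ, ‖F x‖ ≤ C * Real.exp (-(a ^ p / p) * |x| ^ p) := by
    have hopen : IsOpen {x : ℝ | C * Real.exp (-(a ^ p / p) * |x| ^ p) < ‖F x‖} := by
      have hc : Continuous fun x : ℝ ↦ |x| ^ p :=
        continuous_abs.rpow_const fun _ ↦ Or.inr hp.le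
      refine isOpen_lt (by fun_prop) ?_
      exact (hFdiff.continuous.comp Complex.continuous_ofReal).norm
    have hnull : volume {x : ℝ | C * Real.exp (-(a ^ p / p) * |x| ^ p) < ‖F x‖} = 0 := by
      have : ∀ᵐ x : ℝ, ¬ C * Real.exp (-(a ^ p / p) * |x| ^ p) < ‖F x‖ := by
        filter_upwards [hfF] with x hx
        rw [← hx, not_lt]
        refine (hfd x).trans_eq ?_
        ring_nf
      simpa [ae_iff] using this
    intro x
    by_contra! h
    have hx : x ∈ {x : ℝ | C * Real.exp (-(a ^ p / p) * |x| ^ p) < ‖F x‖} := h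
    rw [(hopen.measure_eq_zero_iff volume).1 hnull] at hx
    exact hx
  have hzero : F = 0 := by
    refine eq_zero_of_growth_of_decay_on_real hFdiff hp1 hp2 (B := 1 / (p * b' ^ p))
      (A := a ^ p / p) (K := max ((Real.sqrt (2 * Real.pi))⁻¹ * K) C) (by positivity) hAB
      (fun z ↦ ?_) fun x ↦ ?_
    · rw [hFdef, norm_mul, Complex.norm_real, Real.norm_of_nonneg (by positivity)]
      calc _ ≤ (Real.sqrt (2 * Real.pi))⁻¹ * (K * Real.exp (1 / (p * b' ^ p) * ‖z‖ ^ p)) := by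
            gcongr
            exact hK z
        _ = (Real.sqrt (2 * Real.pi))⁻¹ * K * Real.exp (1 / (p * b' ^ p) * ‖z‖ ^ p) := by ring
        _ ≤ _ := by
            gcongr
            exact le_max_left _ _
    · refine (hreal x).trans ?_
      gcongr
      exact le_max_right _ _
  filter_upwards [hfF] with x hx
  rw [hx, hzero, Pi.zero_apply]
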